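/- Let k ≥ 1 be an integer with k ≢ 3 (mod 9) such that D is squarefree, and let p be a prime such that S_k(x) is irreducible in 𝔽_p[x]. Let θ be a root of the irreducible polynomial S_k(x^p), let L = ℚ(θ), and let Z_L be the ring of integers of L. Then p is a k-Shanks prime if and only if p divides the index [Z_L : ℤ[θ]]. -/

import Mathlib

open Polynomial IntermediateField

/-- The sequence `U₀ = U₁ = 0`, `U₂ = 1`,
`U_n = k·U_{n−1} + (k+3)·U_{n−2} + U_{n−3}` for `n ≥ 3`. -/
def shanksSeq (k : ℤ) : ℕ → ℤ
  | 0 => 0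
  | 1 => 0
  | 2 => 1
  | n + 3 => k * shanksSeq k (n + 2) + (k + 3) * shanksSeq k (n + 1) + shanksSeq k n

/-- `π(m)`: the least period of the sequence `(U_n)` modulo `m`. -/
noncomputable def shanksPeriod (k : ℤ) (m : ℕ) : ℕ :=
  sInf {n : ℕ | 0 < n ∧ ∀ j : ℕ, (shanksSeq k (j + n) : ZMod m) = (shanksSeq k j : ZMod m)}

/-- A prime `p` is a `k`-Shanks prime if `π(p²) = π(p)`. -/
def IsShanksPrime (k : ℤ) (p : ℕ) : Prop :=
  p.Prime ∧ shanksPeriod k (p ^ 2) = shanksPeriod k p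

/-- The Shanks polynomial `S_k`. -/
noncomputable def shanksPoly (k : ℤ) : ℤ[X] := X ^ 3 - C k * X ^ 2 - C (k + 3) * X - 1

theorem shanksPoly_natDegree (k : ℤ) : (shanksPoly k).natDegree = 3 := by
  unfold shanksPoly
  compute_degree!

theorem shanksPoly_monic (k : ℤ) : (shanksPoly k).Monic := by
  unfold shanksPoly
  monicity!

theorem aeval_shanksPoly {A : Type*} [CommRing A] (k : ℤ) (x : A) :
    aeval x (shanksPoly k) = x ^ 3 - k * x ^ 2 - (k + 3) * x - 1 := by
  simp [shanksPoly, map_ofNat]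

theorem sInf_pow_eq_one {M : Type*} [Monoid M] (x : M) :
    sInf {n : ℕ | 0 < n ∧ x ^ n = 1} = orderOf x := by
  by_cases h : IsOfFinOrder x
  · refine le_antisymm (Nat.sInf_le ⟨h.orderOf_pos, pow_orderOf_eq_one x⟩) ?_
    refine le_csInf ⟨_, h.orderOf_pos, pow_orderOf_eq_one x⟩ ?_
    rintro n ⟨hn, hx⟩
    exact orderOf_le_of_pow_eq_one hn hx
  · rw [orderOf_eq_zero h, Nat.sInf_eq_zero]
    right
    ext n
    simp only [Set.mem_ofPred_eq, Set.mem_empty_iff_false, iff_false]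
    rintro ⟨hn, hx⟩
    exact h (isOfFinOrder_iff_pow_eq_one.2 ⟨n, hn, hx⟩)

theorem pow_succ_eq_shanksSeq {A : Type*} [CommRing A] (k : ℤ) (x : A)
    (hx : aeval x (shanksPoly k) = 0) (j : ℕ) :
    x ^ (j + 1) = shanksSeq k (j + 1) * x ^ 2 +
      (shanksSeq k (j + 2) - k * shanksSeq k (j + 1)) * x + shanksSeq k j := by
  rw [aeval_shanksPoly] at hx
  induction j with
  | zero => simp [shanksSeq]
  | succ j ih =>
    rw [pow_succ, ih]
    have : shanksSeq k (j + 1 + 2) = k * shanksSeq k (j + 2) + (k + 3) * shanksSeq k (j + 1) +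
      shanksSeq k j := rfl
    rw [this]
    push_cast
    linear_combination (shanksSeq k (j + 1) : A) * hx

/-- The ring `(ℤ/m)[x]/(S_k)`. -/
abbrev ShanksRing (k : ℤ) (m : ℕ) : Type :=
  AdjoinRoot ((shanksPoly k).map (Int.castRingHom (ZMod m)))

/-- The class of `x` in `(ℤ/m)[x]/(S_k)`. -/
noncomputable def shanksRoot (k : ℤ) (m : ℕ) : ShanksRing k m :=
  AdjoinRoot.root _

theorem aeval_shanksRoot (k : ℤ) (m : ℕ) (P : ℤ[X]) :
    aeval (shanksRoot k m) P = AdjoinRoot.mk _ (P.map (Int.castRingHom (ZMod m))) := by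
  rw [← AdjoinRoot.aeval_eq]
  exact (aeval_map_algebraMap (ZMod m) (shanksRoot k m) P).symm

theorem exists_eq_add_C_mul_of_map_eq {m : ℕ} {P Q : ℤ[X]}
    (h : P.map (Int.castRingHom (ZMod m)) = Q.map (Int.castRingHom (ZMod m))) :
    ∃ B : ℤ[X], P = Q + C (m : ℤ) * B := by
  have : C (m : ℤ) ∣ P - Q := by
    rw [C_dvd_iff_dvd_coeff]
    intro i
    rw [← ZMod.intCast_zmod_eq_zero_iff_dvd, ← eq_intCast (Int.castRingHom (ZMod m)), ← coeff_map,
      Polynomial.map_sub, h, sub_self, coeff_zero]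
  obtain ⟨B, hB⟩ := this
  exact ⟨B, by rw [← hB]; ring⟩

theorem exists_eq_mul_add_C_mul_of_map_dvd {m : ℕ} {P Q : ℤ[X]}
    (h : Q.map (Int.castRingHom (ZMod m)) ∣ P.map (Int.castRingHom (ZMod m))) :
    ∃ A B : ℤ[X], P = Q * A + C (m : ℤ) * B := by
  obtain ⟨R, hR⟩ := h
  obtain ⟨A, rfl⟩ := map_surjective (Int.castRingHom (ZMod m)) (ZMod.ringHom_surjective _) R
  rw [← Polynomial.map_mul] at hR
  exact ⟨A, exists_eq_add_C_mul_of_map_eq hR⟩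

theorem aeval_shanksRoot_eq_zero_iff (k : ℤ) (m : ℕ) (P : ℤ[X]) :
    aeval (shanksRoot k m) P = 0 ↔ ∃ A B : ℤ[X], P = shanksPoly k * A + C (m : ℤ) * B := by
  rw [aeval_shanksRoot, AdjoinRoot.mk_eq_zero]
  constructor
  · exact exists_eq_mul_add_C_mul_of_map_dvd
  · rintro ⟨A, B, rfl⟩
    simp

theorem aeval_shanksRoot_shanksPoly (k : ℤ) (m : ℕ) :
    aeval (shanksRoot k m) (shanksPoly k) = 0 :=
  (aeval_shanksRoot_eq_zero_iff k m _).2 ⟨1, 0, by ring⟩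

theorem intCast_eq_zero_of_quadratic_shanksRoot {k : ℤ} {m : ℕ} (hm : 1 < m) {a b c : ℤ}
    (h : (a : ShanksRing k m) * shanksRoot k m ^ 2 + b * shanksRoot k m + c = 0) :
    (c : ZMod m) = 0 := by
  have : Fact (1 < m) := ⟨hm⟩
  have h' : aeval (shanksRoot k m) (C a * X ^ 2 + C b * X + C c) = 0 := by
    simpa using h
  rw [aeval_shanksRoot, AdjoinRoot.mk_eq_zero] at h'
  by_contra hc
  have hne : (C a * X ^ 2 + C b * X + C c : ℤ[X]).map (Int.castRingHom (ZMod m)) ≠ 0 := by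
    intro h0
    apply hc
    simpa using congrArg (fun P => P.coeff 0) h0
  refine ((shanksPoly_monic k).map _).not_dvd_of_natDegree_lt hne ?_ h'
  rw [(shanksPoly_monic k).natDegree_map, shanksPoly_natDegree]
  exact lt_of_le_of_lt (natDegree_map_le.trans natDegree_quadratic_le) (by norm_num)

theorem isUnit_of_aeval_shanksPoly {A : Type*} [CommRing A] {k : ℤ} {x : A}
    (hx : aeval x (shanksPoly k) = 0) : IsUnit x := by
  rw [aeval_shanksPoly] at hx
  exact IsUnit.of_mul_eq_one (x ^ 2 - k * x - (k + 3)) (by linear_combination hx)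

theorem shanksRoot_pow_eq_one_iff (k : ℤ) (m n : ℕ) (hm : 1 < m) :
    (∀ j, (shanksSeq k (j + n) : ZMod m) = shanksSeq k j) ↔ shanksRoot k m ^ n = 1 := by
  have hroot := aeval_shanksRoot_shanksPoly k m
  constructor
  · intro h
    have key : ∀ j, (shanksSeq k (n + j) : ShanksRing k m) = shanksSeq k j := by
      intro j
      have := congrArg (algebraMap (ZMod m) (ShanksRing k m)) (h j)
      rwa [map_intCast, map_intCast, add_comm] at this
    have h1 := pow_succ_eq_shanksSeq k _ hroot n
    rw [key 1, key 2, ← add_zero n, key 0] at h1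
    simp only [shanksSeq, Int.cast_zero, Int.cast_one, add_zero, mul_zero, sub_zero, zero_mul,
      zero_add, one_mul, pow_succ] at h1
    exact (isUnit_of_aeval_shanksPoly hroot).mul_right_cancel (by rw [h1, one_mul])
  · intro h j
    have h1 := pow_succ_eq_shanksSeq k _ hroot (j + n)
    have h2 := pow_succ_eq_shanksSeq k _ hroot j
    have h3 : shanksRoot k m ^ (j + n + 1) = shanksRoot k m ^ (j + 1) := by
      rw [add_right_comm, pow_add, h, mul_one]
    rw [← sub_eq_zero, ← Int.cast_sub]
    refine intCast_eq_zero_of_quadratic_shanksRoot (k := k) hm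
      (a := shanksSeq k (j + n + 1) - shanksSeq k (j + 1))
      (b := shanksSeq k (j + n + 2) - k * shanksSeq k (j + n + 1) -
        (shanksSeq k (j + 2) - k * shanksSeq k (j + 1))) ?_
    push_cast
    linear_combination h3 - h1 + h2

theorem shanksPeriod_eq (k : ℤ) (m : ℕ) (hm : 1 < m) :
    shanksPeriod k m = orderOf (shanksRoot k m) := by
  simp only [← sInf_pow_eq_one, shanksPeriod, shanksRoot_pow_eq_one_iff k m _ hm]

theorem map_aeval_int {A B : Type*} [CommRing A] [CommRing B] (φ : A →+* B) (y : A) (P : ℤ[X]) :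
    φ (aeval y P) = aeval (φ y) P :=
  (aeval_algHom_apply φ.toIntAlgHom y P).symm

theorem pow_eq_self_iff_of_isUnit {M : Type*} [CommRing M] {y : M} (hy : IsUnit y) {n : ℕ}
    (hn : 0 < n) : y ^ n = y ↔ y ^ (n - 1) = 1 := by
  rw [← hy.mul_left_inj (b := y ^ (n - 1)), ← pow_succ, Nat.sub_add_cancel hn, one_mul]

section Lifting

variable {A F : Type*} [CommRing A] [Field F] {p : ℕ} {π : A →+* F}

theorem isUnit_of_map_ne_zero (hsurj : Function.Surjective π)
    (hker : ∀ a, π a = 0 → ∃ b, a = p * b) (hp2 : (p : A) ^ 2 = 0) {a : A} (ha : π a ≠ 0) :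
    IsUnit a := by
  obtain ⟨b, hb⟩ := hsurj (π a)⁻¹
  obtain ⟨c, hc⟩ := hker (a * b - 1)
    (by rw [map_sub, map_mul, hb, mul_inv_cancel₀ ha, map_one, sub_self])
  exact IsUnit.of_mul_eq_one (b * (1 - p * c))
    (by linear_combination (1 - p * c) * hc - c ^ 2 * hp2)

theorem pow_eq_pow_of_map_eq (hker : ∀ a, π a = 0 → ∃ b, a = p * b) (hp2 : (p : A) ^ 2 = 0)
    {a b : A} (h : π a = π b) : a ^ p = b ^ p := by
  obtain ⟨c, hc⟩ := hker (a - b) (by rw [map_sub, h, sub_self])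
  have := dvd_sub_pow_of_dvd_sub (p := p) ⟨c, hc⟩ 1
  rw [pow_one, hp2, zero_dvd_iff] at this
  exact sub_eq_zero.1 this

theorem root_unique_of_map_eq (hsurj : Function.Surjective π)
    (hker : ∀ a, π a = 0 → ∃ b, a = p * b) (hp2 : (p : A) ^ 2 = 0) (S : ℤ[X]) {u v : A}
    (hu : aeval u S = 0) (hv : aeval v S = 0) (hsep : aeval (π v) (derivative S) ≠ 0)
    (h : π u = π v) : u = v := by
  obtain ⟨c, hc⟩ := hker (u - v) (by rw [map_sub, h, sub_self])
  obtain ⟨d, hd⟩ := (S.map (Int.castRingHom A)).binomExpansion v (u - v)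
  have hunit : IsUnit (aeval v (derivative S)) := by
    refine isUnit_of_map_ne_zero hsurj hker hp2 ?_
    rwa [map_aeval_int]
  rw [add_sub_cancel, derivative_map, eval_map, eval_map, eval_map] at hd
  change aeval u S = aeval v S + aeval v (derivative S) * (u - v) + d * (u - v) ^ 2 at hd
  rw [hu, hv, zero_add, hc, mul_pow, hp2, zero_mul, mul_zero, add_zero] at hd
  rw [← sub_eq_zero, hc]
  exact (hunit.mul_right_eq_zero).1 hd.symm

theorem exists_root_of_map_root (hsurj : Function.Surjective π)
    (hker : ∀ a, π a = 0 → ∃ b, a = p * b) (hp2 : (p : A) ^ 2 = 0) (S : ℤ[X]) {y : A}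
    (hy : aeval (π y) S = 0) (hsep : aeval (π y) (derivative S) ≠ 0) :
    ∃ z, aeval z S = 0 ∧ π z = π y := by
  have hmap := map_aeval_int π y
  obtain ⟨c, hc⟩ := hker (aeval y S) (by rw [hmap, hy])
  obtain ⟨e, he⟩ := (isUnit_of_map_ne_zero hsurj hker hp2
    (a := aeval y (derivative S)) (by rwa [hmap])).exists_right_inv
  obtain ⟨d, hd⟩ := (S.map (Int.castRingHom A)).binomExpansion y (-(p * c * e))
  rw [derivative_map, eval_map, eval_map, eval_map] at hd
  change aeval _ S = aeval y S + aeval y (derivative S) * _ + d * _ at hd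
  have hpF : (p : F) = 0 := by
    have := congrArg π hp2
    simpa using this
  refine ⟨y + -(p * c * e), ?_, by simp [hpF]⟩
  rw [hd, hc]
  linear_combination -(p * c) * he + d * c ^ 2 * e ^ 2 * hp2

/-- A root `x` of `S` in `A` is a Teichmüller representative exactly when raising to the `p`-th
power sends it to another root of `S`. -/
theorem aeval_pow_eq_zero_iff (hsurj : Function.Surjective π)
    (hker : ∀ a, π a = 0 → ∃ b, a = p * b) (hp2 : (p : A) ^ 2 = 0) (hp : p.Prime) (S : ℤ[X]) {x : A}
    (hx : aeval x S = 0) (hsep : aeval (π x) (derivative S) ≠ 0)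
    (hx3 : π x ^ p ^ 3 = π x)
    (hlift : ∀ y : A, aeval y S = 0 → ∃ φ : A →+* A, φ x = y) :
    aeval (x ^ p) S = 0 ↔ x ^ p ^ 3 = x := by
  have hpF : (p : F) = 0 := by
    have := congrArg π hp2
    simpa using this
  have : Fact p.Prime := ⟨hp⟩
  have : CharP F p := (CharP.charP_iff_prime_eq_zero hp).2 hpF
  have hfrob : ∀ P : ℤ[X], aeval (π (x ^ p)) P = aeval (π x) P ^ p := fun P => by
    change _ = frobenius F p _
    rw [map_aeval_int, map_pow, frobenius_def]
  constructor
  · intro h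
    obtain ⟨φ, hφ⟩ := hlift _ h
    have h2 := congrArg φ h
    rw [map_aeval_int, map_pow, hφ, map_zero] at h2
    have h3 := congrArg φ h2
    rw [map_aeval_int, map_pow, map_pow, hφ, map_zero, ← pow_mul, ← pow_mul, ← pow_three] at h3
    exact root_unique_of_map_eq hsurj hker hp2 S h3 hx hsep (by rw [map_pow, hx3])
  · intro h
    have hπx : aeval (π x) S = 0 := by
      rw [← map_zero π, ← hx, map_aeval_int]
    obtain ⟨z, hz, hzy⟩ := exists_root_of_map_root hsurj hker hp2 S (y := x ^ p)
      (by rw [hfrob, hπx, zero_pow hp.ne_zero]) (by rw [hfrob]; exact pow_ne_zero _ hsep)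
    obtain ⟨φ, rfl⟩ := hlift z hz
    have h1 := pow_eq_pow_of_map_eq hker hp2 hzy
    have h2 : (φ x) ^ p ^ 3 = φ x := by rw [← map_pow, h]
    have h3 : (x ^ p) ^ p ^ 3 = x ^ p := by rw [← pow_mul, mul_comm, pow_mul, h]
    have : φ x = x ^ p := by
      rw [← h2, ← h3, pow_succ', pow_mul, pow_mul, h1]
    rw [← this, hz]

theorem orderOf_eq_orderOf_map_iff (hker : ∀ a, π a = 0 → ∃ b, a = p * b)
    (hp2 : (p : A) ^ 2 = 0) (hp : p.Prime) {x : A} (hx : IsUnit x) (hx3 : π x ^ p ^ 3 = π x) :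
    orderOf x = orderOf (π x) ↔ x ^ p ^ 3 = x := by
  have hpos : 0 < p ^ 3 := pow_pos hp.pos 3
  have hn := (pow_eq_self_iff_of_isUnit (hx.map π) hpos).1 hx3
  rw [pow_eq_self_iff_of_isUnit hx hpos]
  constructor
  · intro h
    rw [← orderOf_dvd_iff_pow_eq_one, h]
    exact orderOf_dvd_of_pow_eq_one hn
  · intro h
    refine Nat.dvd_antisymm ?_ (orderOf_map_dvd (π : A →* F) x)
    have h1 : x ^ (orderOf (π x) * p) = 1 := by
      rw [pow_mul, ← one_pow p]
      exact pow_eq_pow_of_map_eq hker hp2 (by rw [map_pow, pow_orderOf_eq_one, map_one])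
    refine Nat.Coprime.dvd_of_dvd_mul_right ?_ (orderOf_dvd_of_pow_eq_one h1)
    refine Nat.Coprime.coprime_dvd_left (orderOf_dvd_of_pow_eq_one h) ?_
    rw [Nat.coprime_comm, hp.coprime_iff_not_dvd]
    intro hd
    have : p ∣ 1 := by
      have := Nat.dvd_sub (dvd_pow_self p (by norm_num : 3 ≠ 0)) hd
      rwa [Nat.sub_sub_self hpos] at this
    exact hp.one_lt.ne' (Nat.dvd_one.1 this)

end Lifting

theorem exists_shanksRing_hom {B : Type*} [CommRing B] {k : ℤ} {m : ℕ} (i : ZMod m →+* B) {y : B}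
    (hy : aeval y (shanksPoly k) = 0) : ∃ φ : ShanksRing k m →+* B, φ (shanksRoot k m) = y := by
  refine ⟨AdjoinRoot.lift i y ?_, AdjoinRoot.lift_root _⟩
  rw [eval₂_map, RingHom.ext_int (i.comp _) (algebraMap ℤ B)]
  exact hy

theorem aeval_shanksRoot_surjective (k : ℤ) (m : ℕ) (a : ShanksRing k m) :
    ∃ P : ℤ[X], aeval (shanksRoot k m) P = a := by
  obtain ⟨Q, rfl⟩ := AdjoinRoot.mk_surjective a
  obtain ⟨P, rfl⟩ := map_surjective (Int.castRingHom (ZMod m)) (ZMod.ringHom_surjective _) Q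
  exact ⟨P, aeval_shanksRoot k m P⟩

theorem shanksRing_natCast_eq_zero (k : ℤ) (m : ℕ) : (m : ShanksRing k m) = 0 := by
  have := (aeval_shanksRoot_eq_zero_iff k m (C (m : ℤ))).2 ⟨0, 1, by ring⟩
  simpa using this

theorem isShanksPrime_iff {k : ℤ} {p : ℕ} (hp : p.Prime)
    (hirr : Irreducible ((shanksPoly k).map (Int.castRingHom (ZMod p)))) :
    IsShanksPrime k p ↔ ∃ A B : ℤ[X],
      (shanksPoly k).comp (X ^ p) = shanksPoly k * A + C ((p : ℤ) ^ 2) * B := by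
  have : Fact p.Prime := ⟨hp⟩
  have hroot := aeval_shanksRoot_shanksPoly k (p ^ 2)
  have hroot' := aeval_shanksRoot_shanksPoly k p
  obtain ⟨π, hπ⟩ : ∃ π : ShanksRing k (p ^ 2) →+* ShanksRing k p, π (shanksRoot k (p ^ 2)) =
      shanksRoot k p := exists_shanksRing_hom ((AdjoinRoot.of _).comp
    (ZMod.castHom (dvd_pow_self p two_ne_zero) (ZMod p))) hroot'
  have hmap : ∀ P : ℤ[X], π (aeval (shanksRoot k (p ^ 2)) P) = aeval (shanksRoot k p) P :=
    fun P => (map_aeval_int π _ P).trans (by rw [hπ]; rfl)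
  have hsurj : Function.Surjective π := by
    intro a
    obtain ⟨P, rfl⟩ := aeval_shanksRoot_surjective k p a
    exact ⟨aeval (shanksRoot k (p ^ 2)) P, hmap P⟩
  have hker : ∀ a, π a = 0 → ∃ b, a = p * b := by
    intro a ha
    obtain ⟨P, rfl⟩ := aeval_shanksRoot_surjective k (p ^ 2) a
    rw [hmap, aeval_shanksRoot_eq_zero_iff] at ha
    obtain ⟨A, B, rfl⟩ := ha
    exact ⟨aeval (shanksRoot k (p ^ 2)) B, by simp [hroot]⟩
  have hp2 : (p : ShanksRing k (p ^ 2)) ^ 2 = 0 := by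
    exact_mod_cast shanksRing_natCast_eq_zero k (p ^ 2)
  have : Fact (Irreducible ((shanksPoly k).map (Int.castRingHom (ZMod p)))) := ⟨hirr⟩
  have hsep : aeval (shanksRoot k p) (derivative (shanksPoly k)) ≠ 0 := by
    have h := PerfectField.separable_of_irreducible hirr
    rw [aeval_shanksRoot, Ne, AdjoinRoot.mk_eq_zero, ← derivative_map]
    intro hd
    exact hirr.not_isUnit (h.isUnit_of_dvd' dvd_rfl hd)
  have hx3 : shanksRoot k p ^ p ^ 3 = shanksRoot k p := by
    have hne := hirr.ne_zero
    have : Module.Finite (ZMod p) (ShanksRing k p) := (AdjoinRoot.powerBasis hne).finite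
    have : Finite (ShanksRing k p) := Module.finite_of_finite (ZMod p)
    have : Fintype (ShanksRing k p) := Fintype.ofFinite _
    have hcard : Fintype.card (ShanksRing k p) = p ^ 3 := by
      rw [Module.card_eq_pow_finrank (K := ZMod p), ZMod.card, (AdjoinRoot.powerBasis hne).finrank,
        AdjoinRoot.powerBasis_dim, (shanksPoly_monic k).natDegree_map, shanksPoly_natDegree]
    rw [← hcard, FiniteField.pow_card]
  rw [← hπ] at hsep hx3
  have hlift : ∀ y : ShanksRing k (p ^ 2), aeval y (shanksPoly k) = 0 →
      ∃ φ : ShanksRing k (p ^ 2) →+* ShanksRing k (p ^ 2), φ (shanksRoot k (p ^ 2)) = y :=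
    fun y hy => exists_shanksRing_hom (AdjoinRoot.of _) hy
  have hp2' : 1 < p ^ 2 := Nat.one_lt_pow two_ne_zero hp.one_lt
  rw [IsShanksPrime, and_iff_right hp, shanksPeriod_eq k _ hp2', shanksPeriod_eq k _ hp.one_lt,
    ← hπ, orderOf_eq_orderOf_map_iff hker hp2 hp (isUnit_of_aeval_shanksPoly hroot) hx3,
    ← aeval_pow_eq_zero_iff hsurj hker hp2 hp _ hroot hsep hx3 hlift]
  have := aeval_shanksRoot_eq_zero_iff k (p ^ 2) ((shanksPoly k).comp (X ^ p))
  rw [aeval_comp] at this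
  rw [aeval_X_pow, Nat.cast_pow] at this
  exact this

section Dedekind

variable {O : Type*} [CommRing O] {p : ℕ} {S f : ℤ[X]} {θ : O}

theorem dvd_of_sq_eq [IsDomain O] [IsIntegrallyClosed O] {q w g h : O} (hq : q ≠ 0)
    (hw : w ^ 2 = q * g * w + q ^ 2 * h) : q ∣ w := by
  have hq' : algebraMap O (FractionRing O) q ≠ 0 := by
    simpa using hq
  have hint : IsIntegral O (algebraMap O (FractionRing O) w / algebraMap O (FractionRing O) q) := by
    refine ⟨X ^ 2 - (C g * X + C h), monic_X_pow_sub (degree_linear_lt), ?_⟩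
    have := congrArg (algebraMap O (FractionRing O)) hw
    simp only [map_pow, map_add, map_mul] at this
    simp only [eval₂_sub, eval₂_add, eval₂_mul, eval₂_pow, eval₂_X, eval₂_C]
    field_simp
    linear_combination this
  obtain ⟨z, hz⟩ := IsIntegrallyClosed.isIntegral_iff.1 hint
  refine ⟨z, IsFractionRing.injective O (FractionRing O) ?_⟩
  rw [map_mul, hz, mul_div_cancel₀ _ hq']

theorem exists_comp_X_pow_eq_pow_add_C_mul (hp : p.Prime) (S : ℤ[X]) :
    ∃ F : ℤ[X], S.comp (X ^ p) = S ^ p + C (p : ℤ) * F := by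
  have : Fact p.Prime := ⟨hp⟩
  refine exists_eq_add_C_mul_of_map_eq ?_
  rw [← expand_eq_comp_X_pow, map_expand, Polynomial.map_pow, ZMod.expand_card]

theorem not_pow_dvd_pow_of_lt {n m : ℕ} {R : Type*} [CommRing R] [IsDomain R] {T : R}
    (hT : Irreducible T) (h : n < m) : ¬ T ^ m ∣ T ^ n := by
  rw [pow_dvd_pow_iff hT.ne_zero hT.not_isUnit]
  exact h.not_ge

theorem exists_dvd_of_root_of_mul_eq [CharZero O] (hp : p.Prime)
    (hirr : Irreducible (S.map (Int.castRingHom (ZMod p))))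
    (hf : S.map (Int.castRingHom (ZMod p)) ∣ f.map (Int.castRingHom (ZMod p)))
    (hdvd : ∀ P : ℤ[X], aeval θ P = 0 → f ∣ P) {F : ℤ[X]} {z : O} (hz : IsIntegral ℤ z)
    (h : z * aeval θ S = aeval θ F) :
    S.map (Int.castRingHom (ZMod p)) ∣ F.map (Int.castRingHom (ZMod p)) := by
  have : Fact p.Prime := ⟨hp⟩
  obtain ⟨q, hq, hqz⟩ := hz
  set n := q.natDegree with hn
  change aeval z q = 0 at hqz
  let H : ℤ[X] := ∑ i ∈ Finset.range (n + 1), C (q.coeff i) * F ^ i * S ^ (n - i)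
  have hH : aeval θ H = 0 := by
    have : aeval θ H = aeval θ S ^ n * aeval z q := by
      rw [aeval_eq_sum_range (p := q), Finset.mul_sum, map_sum]
      refine Finset.sum_congr rfl fun i hi => ?_
      have hi : i ≤ n := Nat.lt_succ_iff.1 (Finset.mem_range.1 hi)
      have hS : aeval θ S ^ n = aeval θ S ^ i * aeval θ S ^ (n - i) := by
        rw [← pow_add, Nat.add_sub_cancel' hi]
      simp only [hS, map_mul, map_pow, ← h, aeval_C, mul_pow, Algebra.smul_def]
      ring
    rw [this, hqz, mul_zero]
  have h1 := hf.trans ((Polynomial.map_dvd (Int.castRingHom (ZMod p))) (hdvd H hH))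
  have h2 : H = ∑ i ∈ Finset.range n, C (q.coeff i) * F ^ i * S ^ (n - i) + F ^ n := by
    simp only [H]
    rw [Finset.sum_range_succ, show q.coeff n = 1 from hq]
    simp
  rw [h2, Polynomial.map_add, Polynomial.map_pow] at h1
  refine hirr.prime.dvd_of_dvd_pow ((dvd_add_right ?_).1 h1)
  rw [Polynomial.map_sum]
  refine Finset.dvd_sum fun i hi => ?_
  rw [Polynomial.map_mul, Polynomial.map_pow]
  exact dvd_mul_of_dvd_right (dvd_pow_self _ (Nat.sub_ne_zero_of_lt (Finset.mem_range.1 hi))) _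

/-- Dedekind's criterion for `S(X ^ p)`, whose reduction modulo `p` is the `p`-th power of the
irreducible polynomial `S`. -/
theorem exists_eq_mul_add_C_sq_mul_iff [IsDomain O] [CharZero O] [IsIntegrallyClosed O]
    [Algebra.IsIntegral ℤ O] (hp : p.Prime)
    (hirr : Irreducible (S.map (Int.castRingHom (ZMod p))))
    (hroot : aeval θ (S.comp (X ^ p)) = 0)
    (hdvd : ∀ P : ℤ[X], aeval θ P = 0 → S.comp (X ^ p) ∣ P) :
    (∃ A B : ℤ[X], S.comp (X ^ p) = S * A + C ((p : ℤ) ^ 2) * B) ↔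
      ∃ z : O, z ∉ Algebra.adjoin ℤ {θ} ∧ (p : O) * z ∈ Algebra.adjoin ℤ {θ} := by
  have : Fact p.Prime := ⟨hp⟩
  have hp0 : (p : O) ≠ 0 := Nat.cast_ne_zero.2 hp.ne_zero
  have hpC : (C (p : ℤ)).map (Int.castRingHom (ZMod p)) = 0 := by simp
  obtain ⟨F, hF⟩ := exists_comp_X_pow_eq_pow_add_C_mul hp S
  have hfmap : (S.comp (X ^ p)).map (Int.castRingHom (ZMod p)) =
      S.map (Int.castRingHom (ZMod p)) ^ p := by
    rw [hF, Polynomial.map_add, Polynomial.map_mul, hpC, zero_mul, add_zero, Polynomial.map_pow]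
  obtain ⟨n, hpn⟩ : ∃ n, p = n + 2 := Nat.exists_eq_add_of_le' hp.two_le
  simp only [Algebra.adjoin_singleton_eq_range_aeval, AlgHom.mem_range]
  rw [hF] at hroot
  simp only [map_add, map_mul, map_pow, map_natCast] at hroot
  constructor
  · rintro ⟨A, B, hAB⟩
    have hA : A.map (Int.castRingHom (ZMod p)) = (S ^ (n + 1)).map (Int.castRingHom (ZMod p)) := by
      refine mul_left_cancel₀ hirr.ne_zero ?_
      have := hfmap
      rw [hAB, map_pow, pow_two, Polynomial.map_add, Polynomial.map_mul, Polynomial.map_mul,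
        Polynomial.map_mul, hpC, zero_mul, zero_mul, add_zero] at this
      rw [this, Polynomial.map_pow, ← pow_succ']
      exact congrArg _ hpn
    obtain ⟨G, rfl⟩ := exists_eq_add_C_mul_of_map_eq hA
    have hs := congrArg (aeval θ) (hF.symm.trans hAB)
    simp only [map_add, map_mul, map_pow, map_natCast] at hs
    rw [hroot] at hs
    obtain ⟨z, hz⟩ := dvd_of_sq_eq (q := (p : O)) (w := aeval θ S ^ (n + 1)) (g := -aeval θ G)
      (h := -(aeval θ S ^ n * aeval θ B)) hp0 (by linear_combination -(aeval θ S ^ n) * hs)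
    refine ⟨z, ?_, S ^ (n + 1), by rw [map_pow, hz]⟩
    rintro ⟨Q, rfl⟩
    have := hdvd (S ^ (n + 1) - C (p : ℤ) * Q) (by
      simp only [map_sub, map_mul, map_pow, map_natCast, hz, sub_self])
    have := Polynomial.map_dvd (Int.castRingHom (ZMod p)) this
    rw [hfmap, Polynomial.map_sub, Polynomial.map_mul, hpC, zero_mul, sub_zero,
      Polynomial.map_pow] at this
    exact not_pow_dvd_pow_of_lt hirr (by omega) this
  · rintro ⟨z, hz, G, hG⟩
    have hG' : ¬ S.map (Int.castRingHom (ZMod p)) ^ p ∣ G.map (Int.castRingHom (ZMod p)) := by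
      rw [← hfmap]
      intro hd
      obtain ⟨Q, R, hQR⟩ := exists_eq_mul_add_C_mul_of_map_dvd hd
      refine hz ⟨R, mul_left_cancel₀ hp0 ?_⟩
      rw [← hG, hQR, hF]
      simp only [map_add, map_mul, map_pow, map_natCast, hroot,
        zero_mul, zero_add]
    obtain ⟨T, V, W, hTW⟩ : ∃ T V W : ℤ[X], S ^ (n + 1) = T * G + V * S.comp (X ^ p) +
        C (p : ℤ) * W := by
      obtain ⟨i, hi, hgcd⟩ := (dvd_prime_pow hirr.prime p).1
        (EuclideanDomain.gcd_dvd_right (G.map (Int.castRingHom (ZMod p)))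
          (S.map (Int.castRingHom (ZMod p)) ^ p))
      have hi' : i ≤ n + 1 := by
        by_contra hlt
        obtain rfl : i = p := by omega
        exact hG' (hgcd.symm.dvd.trans (EuclideanDomain.gcd_dvd_left _ _))
      obtain ⟨E, hE⟩ := hgcd.dvd.trans (pow_dvd_pow _ hi')
      rw [EuclideanDomain.gcd_eq_gcd_ab] at hE
      obtain ⟨T, hT⟩ := map_surjective (Int.castRingHom (ZMod p)) (ZMod.ringHom_surjective _)
        (EuclideanDomain.gcdA (G.map (Int.castRingHom (ZMod p)))
          (S.map (Int.castRingHom (ZMod p)) ^ p) * E)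
      obtain ⟨V, hV⟩ := map_surjective (Int.castRingHom (ZMod p)) (ZMod.ringHom_surjective _)
        (EuclideanDomain.gcdB (G.map (Int.castRingHom (ZMod p)))
          (S.map (Int.castRingHom (ZMod p)) ^ p) * E)
      refine ⟨T, V, exists_eq_add_C_mul_of_map_eq ?_⟩
      rw [Polynomial.map_pow, hE, Polynomial.map_add, Polynomial.map_mul, Polynomial.map_mul, hfmap,
        hT, hV]
      ring
    have hs := congrArg (aeval θ) hTW
    rw [hF] at hs
    simp only [map_add, map_mul, map_pow, map_natCast, hroot, hG, mul_zero, add_zero] at hs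
    have hz' : (aeval θ T * z + aeval θ W) * aeval θ S = aeval θ (-F) := by
      refine mul_left_cancel₀ hp0 ?_
      rw [map_neg]
      linear_combination hroot - aeval θ S * hs - congrArg (aeval θ S ^ ·) hpn
    have hSF := exists_dvd_of_root_of_mul_eq hp hirr (f := S.comp (X ^ p))
      (by rw [hfmap]; exact dvd_pow_self _ hp.ne_zero) hdvd (Algebra.IsIntegral.isIntegral _) hz'
    obtain ⟨A, B, hAB⟩ := exists_eq_mul_add_C_mul_of_map_dvd hSF
    refine ⟨S ^ (n + 1) - C (p : ℤ) * A, -B, ?_⟩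
    rw [hF, map_pow]
    linear_combination congrArg (S ^ ·) hpn - C (p : ℤ) * hAB

end Dedekind

theorem dvd_index_iff {O : Type*} [CommRing O] {p : ℕ} (hp : p.Prime) (H : AddSubgroup O)
    (hH : H.index ≠ 0) : p ∣ H.index ↔ ∃ z, z ∉ H ∧ (p : O) * z ∈ H := by
  have : Fact p.Prime := ⟨hp⟩
  have hmem : ∀ z : O, (p : O) * z ∈ H ↔ p • (QuotientAddGroup.mk z : O ⧸ H) = 0 := fun z => by
    rw [← QuotientAddGroup.mk_nsmul, QuotientAddGroup.eq_zero_iff, nsmul_eq_mul]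
  have : Finite (O ⧸ H) := Nat.finite_of_card_ne_zero hH
  constructor
  · intro h
    obtain ⟨x, hx⟩ := exists_prime_addOrderOf_dvd_card' (G := O ⧸ H) p h
    obtain ⟨z, rfl⟩ := QuotientAddGroup.mk_surjective x
    refine ⟨z, fun hz => ?_, (hmem z).2 (by rw [← hx, addOrderOf_nsmul_eq_zero])⟩
    rw [(QuotientAddGroup.eq_zero_iff z).2 hz, addOrderOf_zero] at hx
    exact hp.one_lt.ne hx
  · rintro ⟨z, hz, hpz⟩
    rw [← addOrderOf_eq_prime ((hmem z).1 hpz)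
      fun h0 => hz ((QuotientAddGroup.eq_zero_iff z).1 h0)]
    exact addOrderOf_dvd_natCard _

theorem index_adjoin_ne_zero {L : Type*} [Field L] [NumberField L]
    (θ : NumberField.RingOfIntegers L) (hgen : ℚ⟮(θ : L)⟯ = ⊤) :
    (Algebra.adjoin ℤ ({θ} : Set (NumberField.RingOfIntegers L))).toSubring.toAddSubgroup.index
      ≠ 0 := by
  set H := (Algebra.adjoin ℤ
    ({θ} : Set (NumberField.RingOfIntegers L))).toSubring.toAddSubgroup with hHdef
  suffices Finite (NumberField.RingOfIntegers L ⧸ H) from Nat.card_ne_zero.2 ⟨inferInstance, this⟩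
  have : Module.Finite ℤ (NumberField.RingOfIntegers L ⧸ H) :=
    Module.Finite.of_surjective (QuotientAddGroup.mk' H).toIntLinearMap
      (QuotientAddGroup.mk'_surjective H)
  refine Module.finite_of_fg_torsion _ ?_
  intro x
  obtain ⟨z, rfl⟩ := QuotientAddGroup.mk_surjective x
  have hz : (z : L) ∈ ℚ⟮(θ : L)⟯.toSubalgebra := by rw [hgen]; trivial
  rw [adjoin_simple_toSubalgebra_of_isAlgebraic (Algebra.IsAlgebraic.isAlgebraic _),
    Algebra.adjoin_singleton_eq_range_aeval] at hz
  obtain ⟨g, hg⟩ := hz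
  obtain ⟨b, hbmem, hb⟩ := IsLocalization.integerNormalization_spec (nonZeroDivisors ℤ) g
  refine ⟨⟨b, hbmem⟩, ?_⟩
  change b • (QuotientAddGroup.mk z : NumberField.RingOfIntegers L ⧸ H) = 0
  rw [← QuotientAddGroup.mk_zsmul, QuotientAddGroup.eq_zero_iff]
  change _ ∈ Algebra.adjoin ℤ _
  rw [Algebra.adjoin_singleton_eq_range_aeval]
  refine ⟨IsLocalization.integerNormalization (nonZeroDivisors ℤ) g,
    NumberField.RingOfIntegers.coe_injective ?_⟩
  change aeval (θ : L) g = z at hg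
  have := congrArg (aeval (θ : L)) hb
  rw [aeval_map_algebraMap, aeval_algebraMap_apply, map_zsmul, hg] at this
  rw [map_zsmul]
  exact this

section Irreducible

variable {k : ℤ}

theorem exists_pos_root_shanksPoly (hk : 1 ≤ k) : ∃ a : ℝ, 0 < a ∧ aeval a (shanksPoly k) = 0 := by
  have hk' : (1 : ℝ) ≤ k := by exact_mod_cast hk
  have hcont : ContinuousOn (fun x : ℝ => x ^ 3 - k * x ^ 2 - (k + 3) * x - 1)
      (Set.Icc 0 (k + 3 : ℝ)) := by fun_prop
  obtain ⟨a, ha, hroot⟩ := intermediate_value_Ioo (by linarith) hcont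
    (show (0 : ℝ) ∈ Set.Ioo _ _ from ⟨by norm_num, by nlinarith⟩)
  exact ⟨a, ha.1, by rw [aeval_shanksPoly]; exact hroot⟩

theorem aeval_shanksPoly_neg_inv {a : ℝ} (ha : 0 < a) (h : aeval a (shanksPoly k) = 0) :
    aeval (-(1 + a)⁻¹) (shanksPoly k) = 0 := by
  rw [aeval_shanksPoly] at h ⊢
  have : 1 + a ≠ 0 := by positivity
  field_simp
  linear_combination -h

theorem aeval_shanksPoly_neg_add_div {a : ℝ} (ha : 0 < a) (h : aeval a (shanksPoly k) = 0) :
    aeval (-((1 + a) / a)) (shanksPoly k) = 0 := by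
  rw [aeval_shanksPoly] at h ⊢
  field_simp
  linear_combination h

theorem eq_prod_X_sub_C_of_natDegree_le {T : ℝ[X]} (hT : T.Monic) (hdeg : T.natDegree ≤ 3)
    {x y z : ℝ} (hxy : x ≠ y) (hxz : x ≠ z) (hyz : y ≠ z) (hx : T.eval x = 0) (hy : T.eval y = 0)
    (hz : T.eval z = 0) : T = (X - C x) * (X - C y) * (X - C z) := by
  have hmonic : ((X - C x) * (X - C y) * (X - C z)).Monic :=
    ((monic_X_sub_C x).mul (monic_X_sub_C y)).mul (monic_X_sub_C z)
  refine (eq_of_monic_of_dvd_of_natDegree_le hmonic hT ?_ ?_)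
  · have hcop : ∀ {u v : ℝ}, u ≠ v → IsCoprime (X - C u) (X - C v) := fun h =>
      isCoprime_X_sub_C_of_isUnit_sub (sub_ne_zero.2 h).isUnit
    exact ((hcop hxz).mul_left (hcop hyz)).mul_dvd
      ((hcop hxy).mul_dvd (dvd_iff_isRoot.2 hx) (dvd_iff_isRoot.2 hy)) (dvd_iff_isRoot.2 hz)
  · rw [((monic_X_sub_C x).mul (monic_X_sub_C y)).natDegree_mul (monic_X_sub_C z),
      (monic_X_sub_C x).natDegree_mul (monic_X_sub_C y)]
    simpa using hdeg

theorem pow_ne_gen (hk : 1 ≤ k) {K : Type*} [Field K] {_ : Algebra ℚ K} (pb : PowerBasis ℚ K)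
    (hpb : minpoly ℚ pb.gen = (shanksPoly k).map (algebraMap ℤ ℚ)) {p : ℕ} (hp : p.Prime)
    (β : K) : β ^ p ≠ pb.gen := by
  intro hβ
  obtain ⟨a, ha, hroot⟩ := exists_pos_root_shanksPoly hk
  have hlift : ∀ y : ℝ, aeval y (shanksPoly k) = 0 → ∃ φ : K →ₐ[ℚ] ℝ, φ β ^ p = y := fun y hy =>
    ⟨pb.lift y (by rw [hpb, aeval_map_algebraMap, hy]), by rw [← map_pow, hβ, pb.lift_gen]⟩
  obtain ⟨φ₁, h₁⟩ := hlift _ hroot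
  obtain ⟨φ₂, h₂⟩ := hlift _ (aeval_shanksPoly_neg_inv ha hroot)
  obtain ⟨φ₃, h₃⟩ := hlift _ (aeval_shanksPoly_neg_add_div ha hroot)
  rcases hp.eq_two_or_odd' with rfl | hodd
  · have : 0 < (1 + a)⁻¹ := by positivity
    nlinarith [sq_nonneg (φ₂ β)]
  set b := φ₁ β
  have hb : 0 < b := hodd.pow_pos_iff.1 (h₁ ▸ ha)
  obtain ⟨c, hcdef⟩ : ∃ c, c = -(φ₂ β)⁻¹ := ⟨_, rfl⟩
  have hcp : c ^ p = 1 + b ^ p := by rw [hcdef, hodd.neg_pow, inv_pow, h₂, h₁]; simp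
  have hc : 0 < c := hodd.pow_pos_iff.1 (by rw [hcp, h₁]; linarith)
  have h₂' : φ₂ β = -c⁻¹ := by simp [hcdef]
  have h₃' : φ₃ β = -(c / b) := hodd.strictMono_pow.injective <| by
    change φ₃ β ^ p = (-(c / b)) ^ p
    rw [h₃, hodd.neg_pow, div_pow, hcp, h₁]
  have hc1 : 1 < c := lt_of_pow_lt_pow_left₀ p hc.le (by rw [hcp, one_pow, h₁]; linarith)
  have hbc : b < c := lt_of_pow_lt_pow_left₀ p hc.le (by rw [hcp]; linarith)
  have hcb : c < 1 + b := by
    refine lt_of_pow_lt_pow_left₀ p (by positivity) ?_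
    obtain ⟨m, hm⟩ : ∃ m, p = m + 1 + 1 := Nat.exists_eq_add_of_le' hp.two_le
    have := pow_add_pow_le zero_le_one hb.le m.succ_ne_zero
    have hbm : 0 < b ^ (m + 1) := by positivity
    rw [hcp, hm, pow_succ, pow_succ (1 + b)]
    rw [one_pow, Nat.succ_eq_add_one] at this
    nlinarith [mul_le_mul_of_nonneg_right this (by linarith : 0 ≤ 1 + b)]
  have hint : IsIntegral ℤ β := by
    refine IsIntegral.of_pow hp.pos (hβ ▸ ⟨shanksPoly k, shanksPoly_monic k, ?_⟩)
    have := minpoly.aeval ℚ pb.gen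
    rwa [hpb, aeval_map_algebraMap] at this
  have := pb.finite
  have hdeg : (minpoly ℤ β).natDegree ≤ 3 := by
    have h := minpoly.natDegree_le (A := ℚ) β
    rw [minpoly.isIntegrallyClosed_eq_field_fractions' ℚ hint, (minpoly.monic hint).natDegree_map,
      pb.finrank, ← pb.natDegree_minpoly, hpb, (shanksPoly_monic k).natDegree_map,
      shanksPoly_natDegree] at h
    exact h
  have heval : ∀ φ : K →ₐ[ℚ] ℝ, ((minpoly ℤ β).map (algebraMap ℤ ℝ)).eval (φ β) = 0 := fun φ => by
    have := minpoly.aeval ℤ β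
    rw [eval_map_algebraMap, ← φ.coe_restrictScalars' ℤ, aeval_algHom_apply, this, map_zero]
  have hcb1 : 1 < c / b := (one_lt_div hb).2 hbc
  have hc0 : 0 < c⁻¹ := by positivity
  have hc1' : c⁻¹ < 1 := inv_lt_one_of_one_lt₀ hc1
  have hprod := eq_prod_X_sub_C_of_natDegree_le ((minpoly.monic hint).map (algebraMap ℤ ℝ))
    (by rwa [(minpoly.monic hint).natDegree_map]) (x := b) (y := φ₂ β) (z := φ₃ β)
    (by rw [h₂']; linarith) (by rw [h₃']; linarith) (by rw [h₂', h₃']; linarith)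
    (heval _) (heval _) (heval _)
  have hval := congrArg (eval (-1)) hprod
  rw [h₂', h₃', eval_map, show (-1 : ℝ) = algebraMap ℤ ℝ (-1) by simp, eval₂_at_apply] at hval
  simp only [eval_mul, eval_sub, eval_X, eval_C, algebraMap_int_eq, eq_intCast] at hval
  have heq : ((eval (-1) (minpoly ℤ β) : ℤ) : ℝ) = (1 + b) * (c - 1) * (c - b) / (b * c) := by
    rw [hval]
    field_simp
    push_cast
    ring
  have hpos : 0 < eval (-1) (minpoly ℤ β) := by
    have : (0 : ℝ) < (eval (-1) (minpoly ℤ β) : ℤ) := by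
      rw [heq]
      have h1 : 0 < c - 1 := by linarith
      have h2 : 0 < c - b := by linarith
      positivity
    exact_mod_cast this
  have hlt : eval (-1) (minpoly ℤ β) < 1 := by
    have : ((eval (-1) (minpoly ℤ β) : ℤ) : ℝ) < 1 := by
      rw [heq, div_lt_one (by positivity)]
      have h1 : 0 < (1 + b) * (c - 1) := mul_pos (by linarith) (by linarith)
      nlinarith
    exact_mod_cast this
  omega

theorem irreducible_shanksPoly_comp_X_pow (hk : 1 ≤ k) {p : ℕ} (hp : p.Prime)
    (hirr : Irreducible (shanksPoly k)) :
    Irreducible (((shanksPoly k).comp (X ^ p)).map (algebraMap ℤ ℚ)) := by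
  rw [Polynomial.map_comp, Polynomial.map_pow, map_X]
  refine irreducible_comp ((shanksPoly_monic k).map _) (monic_X_pow p)
    (((shanksPoly_monic k).irreducible_iff_irreducible_map_fraction_map).1 hirr)
    fun E _ _ x hx => ?_
  rw [Polynomial.map_pow, map_X]
  refine X_pow_sub_C_irreducible_of_prime hp fun β => ?_
  have hint : IsIntegral ℚ x := by
    refine minpoly.ne_zero_iff.1 ?_
    rw [hx]
    exact ((shanksPoly_monic k).map _).ne_zero
  have := pow_ne_gen hk (adjoin.powerBasis hint)
    (by rw [adjoin.powerBasis_gen, minpoly_gen, hx]) hp β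
  rwa [adjoin.powerBasis_gen] at this

theorem dvd_of_aeval_eq_zero {L : Type*} [Field L] [CharZero L] {f : ℤ[X]} (hf : f.Monic)
    (hirr : Irreducible (f.map (algebraMap ℤ ℚ))) {θ : L} (hθ : aeval θ f = 0) {P : ℤ[X]}
    (hP : aeval θ P = 0) : f ∣ P := by
  refine (map_dvd_map (algebraMap ℤ ℚ) (RingHom.injective_int _) hf).1 ?_
  rw [minpoly.eq_of_irreducible_of_monic hirr (x := θ)
    (by rw [aeval_map_algebraMap, hθ]) (hf.map _)]
  exact minpoly.dvd ℚ θ (by rw [aeval_map_algebraMap, hP])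

end Irreducible

/-- Let `k ≥ 1` with `k ≢ 3 (mod 9)` be such that `D` is
squarefree, and let `p` be a prime such that the Shanks polynomial
`S_k(x) = x³ − k·x² − (k+3)·x − 1` is irreducible in `𝔽_p[x]`.  Let `θ` be a
root of the irreducible polynomial `S_k(x^p)`, `L = ℚ(θ)` and `Z_L` the ring of
integers of `L`.  Then `p` is a `k`-Shanks prime iff `p ∣ [Z_L : ℤ[θ]]`. -/
theorem shanks_prime_iff_index (k : ℤ) (hk : 1 ≤ k) (hk9 : ¬ k ≡ 3 [ZMOD 9])
    (hD : Squarefree (if (3 : ℤ) ∣ k then (k / 3) ^ 2 + k / 3 + 1 else k ^ 2 + 3 * k + 9))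
    (p : ℕ) (hp : p.Prime)
    (hirr : Irreducible (X ^ 3 - C (k : ZMod p) * X ^ 2 - C ((k : ZMod p) + 3) * X - 1))
    (L : Type*) [Field L] [NumberField L] (θ : NumberField.RingOfIntegers L)
    (hθ : θ ^ (3 * p) - (k : NumberField.RingOfIntegers L) * θ ^ (2 * p)
      - ((k : NumberField.RingOfIntegers L) + 3) * θ ^ p - 1 = 0)
    (hgen : ℚ⟮(θ : L)⟯ = ⊤) :
    IsShanksPrime k p ↔
      (p : ℕ) ∣ (Algebra.adjoin ℤ
        ({θ} : Set (NumberField.RingOfIntegers L))).toSubring.toAddSubgroup.index := by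
  have : Fact p.Prime := ⟨hp⟩
  have hirr' : Irreducible ((shanksPoly k).map (Int.castRingHom (ZMod p))) := by
    convert hirr using 1
    simp [shanksPoly, C_ofNat]
  have hroot : aeval θ ((shanksPoly k).comp (X ^ p)) = 0 := by
    rw [aeval_comp, aeval_shanksPoly, ← hθ]
    simp only [map_pow, aeval_X]
    ring
  have hmonic : ((shanksPoly k).comp (X ^ p)).Monic :=
    (shanksPoly_monic k).comp (monic_X_pow p) (by simpa using hp.ne_zero)
  have hrootL : ∀ P : ℤ[X], aeval θ P = 0 → aeval (θ : L) P = 0 := fun P hP => by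
    rw [aeval_algebraMap_apply, hP, map_zero]
  have hdvd : ∀ P : ℤ[X], aeval θ P = 0 → (shanksPoly k).comp (X ^ p) ∣ P := fun P hP =>
    dvd_of_aeval_eq_zero hmonic (irreducible_shanksPoly_comp_X_pow hk hp
      ((shanksPoly_monic k).irreducible_of_irreducible_map _ _ hirr')) (hrootL _ hroot)
      (hrootL _ hP)
  rw [isShanksPrime_iff hp hirr', exists_eq_mul_add_C_sq_mul_iff hp hirr' hroot hdvd,
    dvd_index_iff hp _ (index_adjoin_ne_zero θ hgen)]
  rfl
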